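/- Canonicity of the germ 𝒦^{γ,β}F: under the assumptions of the Schauder estimates for coherent germs (α ≤ γ, γ ≠ 0, F an (α,γ)-coherent germ, R a γ-reconstruction, β > 0 with α+β ≠ 0, γ+β ∉ ℕ₀, 𝖪 a β-regularising kernel of order (m,r), m > γ+β, r > −α), suppose a germ is postulated in the form G_x = 𝖪F_x − P_x with P_x a polynomial of degree < γ+β for each x. If 𝖪R is a (γ+β)-reconstruction of G (i.e. |(G_x − 𝖪R)(φ_x^λ)| ≲ λ^{γ+β} uniformly over x in compacts, λ ∈ (0,1], φ ∈ 𝓑^r for r > −(α+β)∧0), then necessarily P_x = 𝒯^{γ+β}_x(𝖪{F_x − R}), the Taylor polynomial of 𝖪{F_x − R} at x of order < γ+β built from the pointwise derivatives. -/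

import Mathlib

open MeasureTheory Metric Filter
open scoped Classical Pointwise Topology

noncomputable section

/-- Euclidean space `ℝ^d`. -/
abbrev Ed (d : ℕ) := EuclideanSpace ℝ (Fin d)

/-- Multi-indices `k ∈ ℕ₀^d`. -/
abbrev MIdx (d : ℕ) := Fin d → ℕ

variable {d : ℕ}

/-- Degree `|k|` of a multi-index. -/
def mdeg (k : MIdx d) : ℕ := ∑ i, k i

/-- Factorial `k!` of a multi-index. -/
def mfact (k : MIdx d) : ℕ := ∏ i, Nat.factorial (k i)

/-- Monomial `v^k`. -/
def mpow (v : Ed d) (k : MIdx d) : ℝ := ∏ i, (v i) ^ (k i)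

/-- Partial (line) derivative in coordinate `i`. -/
def pd (i : Fin d) (f : Ed d → ℝ) : Ed d → ℝ :=
  fun x => lineDeriv ℝ f x (EuclideanSpace.single i (1:ℝ))

/-- Iterated partial derivative `∂^k`. -/
def mderiv (k : MIdx d) (f : Ed d → ℝ) : Ed d → ℝ :=
  (List.finRange d).foldr (fun i g => (pd i)^[k i] g) f

/-- Smooth compactly supported test function. -/
def IsTest (φ : Ed d → ℝ) : Prop := ContDiff ℝ (⊤ : ℕ∞) φ ∧ HasCompactSupport φ

/-- The `C^r` norm `max_{|k| ≤ r} ‖∂^k φ‖_∞`. -/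
def crNorm (r : ℕ) (φ : Ed d → ℝ) : ℝ :=
  ⨆ k : {k : MIdx d // mdeg k ≤ r}, ⨆ x : Ed d, |mderiv k.1 φ x|

/-- Generalized functions: arbitrary functionals on functions on `ℝ^d`. -/
abbrev DFunc (d : ℕ) := (Ed d → ℝ) → ℝ

/-- `f` is a distribution in `𝒟'(ℝ^d)`: linear on test functions and,
on every compact, bounded by some `C^r` norm. -/
def IsDistribution (f : DFunc d) : Prop :=
  (∀ φ ψ : Ed d → ℝ, IsTest φ → IsTest ψ → f (φ + ψ) = f φ + f ψ) ∧
  (∀ (c : ℝ) (φ : Ed d → ℝ), IsTest φ → f (c • φ) = c * f φ) ∧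
  (∀ K : Set (Ed d), IsCompact K → ∃ (r : ℕ) (C : ℝ),
    ∀ φ : Ed d → ℝ, IsTest φ → tsupport φ ⊆ K → |f φ| ≤ C * crNorm r φ)

/-- `f` is a distribution of order `r` (bound by the `C^r` norm on every compact). -/
def DistOrder (f : DFunc d) (r : ℕ) : Prop :=
  ∀ K : Set (Ed d), IsCompact K → ∃ C : ℝ,
    ∀ φ : Ed d → ℝ, IsTest φ → tsupport φ ⊆ K → |f φ| ≤ C * crNorm r φ

/-- `φ` is of class `C^r`: all iterated coordinate-partials up to order `r`
exist and are continuous. -/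
def IsCr (r : ℕ) (φ : Ed d → ℝ) : Prop :=
  ∀ k : MIdx d, mdeg k ≤ r →
    Continuous (mderiv k φ) ∧
    (mdeg k < r → ∀ (i : Fin d) (x : Ed d),
      LineDifferentiableAt ℝ (mderiv k φ) x (EuclideanSpace.single i (1:ℝ)))

/-- The functional `f` acts canonically (linearly, with local order-`r` bounds) on all
compactly supported `C^r` functions; i.e. `f` incorporates the canonical extension of a
distribution of order `r`. -/
def OrderExt (f : DFunc d) (r : ℕ) : Prop :=
  (∀ φ ψ : Ed d → ℝ, IsCr r φ → HasCompactSupport φ → IsCr r ψ → HasCompactSupport ψ →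
      f (φ + ψ) = f φ + f ψ) ∧
  (∀ (c : ℝ) (φ : Ed d → ℝ), IsCr r φ → HasCompactSupport φ → f (c • φ) = c * f φ) ∧
  (∀ K : Set (Ed d), IsCompact K → ∃ C : ℝ,
    ∀ φ : Ed d → ℝ, IsCr r φ → HasCompactSupport φ → tsupport φ ⊆ K → |f φ| ≤ C * crNorm r φ)

/-- The scaled recentred test function `φ_x^λ(y) = λ^{-d} φ(λ^{-1}(y-x))`. -/
def scTF (φ : Ed d → ℝ) (x : Ed d) (l : ℝ) : Ed d → ℝ :=
  fun y => (l ^ d)⁻¹ * φ (l⁻¹ • (y - x))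

/-- The class `𝓑^r` of smooth test functions supported in the closed unit ball with
all derivatives of order `≤ r` bounded by one. -/
def TB (d r : ℕ) : Set (Ed d → ℝ) :=
  {φ | IsTest φ ∧ tsupport φ ⊆ closedBall (0 : Ed d) 1 ∧
    ∀ k : MIdx d, mdeg k ≤ r → ∀ x, |mderiv k φ x| ≤ 1}

/-- The class `𝓑_γ` of smooth test functions supported in the closed unit ball which
annihilate all monomials of degree `≤ γ`. -/
def TAnn (d : ℕ) (γ : ℝ) : Set (Ed d → ℝ) :=
  {φ | IsTest φ ∧ tsupport φ ⊆ closedBall (0 : Ed d) 1 ∧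
    ∀ k : MIdx d, (mdeg k : ℝ) ≤ γ → (∫ z, φ z * mpow z k) = 0}

/-- The class `𝓑^r_γ = 𝓑^r ∩ 𝓑_γ`. -/
def TBAnn (d r : ℕ) (γ : ℝ) : Set (Ed d → ℝ) := TB d r ∩ TAnn d γ

/-- A germ: a family of functionals indexed by base points. -/
abbrev GermF (d : ℕ) := Ed d → DFunc d

/-- A germ of distributions, measurable in the base point. -/
def IsGerm (F : GermF d) : Prop :=
  (∀ x, IsDistribution (F x)) ∧ ∀ φ : Ed d → ℝ, IsTest φ → Measurable (fun x => F x φ)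

/-- Homogeneity bound with constant `C`: `|F_x(φ_x^λ)| ≤ C λ^ᾱ` on `(K, λ̄)` at order `r`. -/
def HomB (F : GermF d) (a : ℝ) (r : ℕ) (K : Set (Ed d)) (lb C : ℝ) : Prop :=
  ∀ x ∈ K, ∀ l : ℝ, 0 < l → l ≤ lb → ∀ φ ∈ TB d r, |F x (scTF φ x l)| ≤ C * l ^ a

/-- Coherence bound with constant `C`:
`|(F_y - F_x)(φ_x^λ)| ≤ C λ^α (|y-x|+λ)^{γ-α}` on `(K, λ̄)` at order `r`. -/
def CohB (F : GermF d) (a g : ℝ) (r : ℕ) (K : Set (Ed d)) (lb C : ℝ) : Prop :=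
  ∀ x ∈ K, ∀ y ∈ K, ∀ l : ℝ, 0 < l → l ≤ lb → ∀ φ ∈ TB d r,
    |F y (scTF φ x l) - F x (scTF φ x l)| ≤ C * l ^ a * (dist y x + l) ^ (g - a)

/-- `F` is `ᾱ`-homogeneous of order `r`. -/
def Homog (F : GermF d) (a : ℝ) (r : ℕ) : Prop :=
  ∀ K : Set (Ed d), IsCompact K → ∀ lb : ℝ, 1 ≤ lb → ∃ C, HomB F a r K lb C

/-- `F` is `(α, γ)`-coherent of order `r`. -/
def Coh (F : GermF d) (a g : ℝ) (r : ℕ) : Prop :=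
  ∀ K : Set (Ed d), IsCompact K → ∀ lb : ℝ, 1 ≤ lb → ∃ C, CohB F a g r K lb C

/-- Weak homogeneity bound with constant `C` (test functions annihilating polynomials
at small scales, plus a scale-one bound on all of `𝓑^r`). -/
def WHomB (F : GermF d) (a : ℝ) (r : ℕ) (K : Set (Ed d)) (lb C : ℝ) : Prop :=
  (∀ x ∈ K, ∀ l : ℝ, 0 < l → l ≤ lb → ∀ φ ∈ TBAnn d r a,
      |F x (scTF φ x l)| ≤ C * l ^ a) ∧
  (∀ x ∈ K, ∀ ψ ∈ TB d r, |F x (scTF ψ x 1)| ≤ C)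

/-- Weak coherence bound with constant `C`. -/
def WCohB (F : GermF d) (a g : ℝ) (r : ℕ) (K : Set (Ed d)) (lb C : ℝ) : Prop :=
  (∀ x ∈ K, ∀ y ∈ K, ∀ l : ℝ, 0 < l → l ≤ lb → ∀ φ ∈ TBAnn d r g,
      |F y (scTF φ x l) - F x (scTF φ x l)| ≤ C * l ^ a * (dist y x + l) ^ (g - a)) ∧
  (∀ x ∈ K, ∀ y ∈ K, ∀ ψ ∈ TB d r, |F y (scTF ψ x 1) - F x (scTF ψ x 1)| ≤ C)

/-- `F` is weakly `ᾱ`-homogeneous of order `r`. -/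
def WHomog (F : GermF d) (a : ℝ) (r : ℕ) : Prop :=
  ∀ K : Set (Ed d), IsCompact K → ∀ lb : ℝ, 1 ≤ lb → ∃ C, WHomB F a r K lb C

/-- `F` is weakly `(α,γ)`-coherent of order `r`. -/
def WCoh (F : GermF d) (a g : ℝ) (r : ℕ) : Prop :=
  ∀ K : Set (Ed d), IsCompact K → ∀ lb : ℝ, 1 ≤ lb → ∃ C, WCohB F a g r K lb C

/-- The canonical order `r_{ᾱ,α} = min{n ∈ ℕ₀ : n > max(-ᾱ, -α)}`. -/
def rJ (a b : ℝ) : ℕ := (⌊max (-a) (-b)⌋ + 1).toNat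

/-- Joint homogeneity-and-coherence bound at the canonical order. -/
def JointB (F : GermF d) (ab a g : ℝ) (K : Set (Ed d)) (lb C : ℝ) : Prop :=
  HomB F ab (rJ ab a) K lb C ∧ CohB F a g (rJ ab a) K lb C

/-- Joint weak homogeneity-and-coherence bound at the canonical order. -/
def WJointB (F : GermF d) (ab a g : ℝ) (K : Set (Ed d)) (lb C : ℝ) : Prop :=
  WHomB F ab (rJ ab a) K lb C ∧ WCohB F a g (rJ ab a) K lb C

/-- `R` is a `γ`-reconstruction of the `(α,γ)`-coherent germ `F`. -/
def IsRec (F : GermF d) (R : DFunc d) (a g : ℝ) : Prop :=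
  ∀ r : ℕ, -a < (r : ℝ) → ∀ K : Set (Ed d), IsCompact K → ∃ C : ℝ,
    ∀ x ∈ K, ∀ l : ℝ, 0 < l → l ≤ 1 → ∀ φ ∈ TB d r,
      |F x (scTF φ x l) - R (scTF φ x l)| ≤ C * l ^ g

/-- Mixed partial derivative `∂_1^k ∂_2^l K(x,y)` of a kernel. -/
def mixDeriv (k l : MIdx d) (Kf : Ed d → Ed d → ℝ) (x y : Ed d) : ℝ :=
  mderiv k (fun x' => mderiv l (fun y' => Kf x' y') y) x

/-- The kernel `K(x,y)` is of class `C^{m,r}` (mixed partials `∂_1^k ∂_2^l`, `|k| ≤ m`,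
`|l| ≤ r`, exist and are continuous). -/
def IsCmr (m r : ℕ) (Kf : Ed d → Ed d → ℝ) : Prop :=
  ∀ k l : MIdx d, mdeg k ≤ m → mdeg l ≤ r →
    Continuous (fun p : Ed d × Ed d => mixDeriv k l Kf p.1 p.2) ∧
    (mdeg k < m → ∀ (i : Fin d) (x y : Ed d),
      LineDifferentiableAt ℝ (fun x' => mixDeriv k l Kf x' y) x
        (EuclideanSpace.single i (1:ℝ))) ∧
    (mdeg l < r → ∀ (j : Fin d) (x y : Ed d),
      LineDifferentiableAt ℝ (mderiv l (fun y' => Kf x y')) y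
        (EuclideanSpace.single j (1:ℝ)))

/-- `Kn` is the dyadic decomposition of a `β`-regularising kernel of order `(m,r)`
with range `ρ` (Definition 2.3 of the paper). -/
def RegKer (d : ℕ) (β : ℝ) (m r : ℕ) (ρ : ℝ) (Kn : ℕ → Ed d → Ed d → ℝ) : Prop :=
  (∀ n, IsCmr m r (Kn n)) ∧
  (∀ n x y, Kn n x y ≠ 0 → dist x y ≤ ρ * 2 ^ (-(n : ℝ))) ∧
  (∀ K : Set (Ed d), IsCompact K → ∃ c : ℝ, 0 < c ∧
    (∀ n, ∀ k l : MIdx d, mdeg k ≤ m → mdeg l ≤ r → ∀ x ∈ K, ∀ y ∈ K,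
      |mixDeriv k l (Kn n) x y| ≤
        c * 2 ^ ((((d : ℝ) - β + (mdeg l : ℝ) + (mdeg k : ℝ))) * n)) ∧
    (∀ n, ∀ k l : MIdx d, mdeg k ≤ r → mdeg l ≤ r → ∀ y ∈ K,
      |∫ x, mpow (y - x) l * mderiv k (fun y' => Kn n x y') y| ≤ c * 2 ^ (-(β * (n : ℝ)))))

/-- `K_n^* ψ (y) = ∫ ψ(x) K_n(x,y) dx`. -/
def kstar (Kf : Ed d → Ed d → ℝ) (ψ : Ed d → ℝ) : Ed d → ℝ :=
  fun y => ∫ x, ψ x * Kf x y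

/-- `g = 𝖪 f`, i.e. `g(ψ) = Σ_n f(K_n^* ψ)` (with convergence) on test functions. -/
def KInt (Kn : ℕ → Ed d → Ed d → ℝ) (f g : DFunc d) : Prop :=
  ∀ ψ : Ed d → ℝ, IsTest ψ → HasSum (fun n => f (kstar (Kn n) ψ)) (g ψ)

/-- The kernel decomposition preserves polynomials at level `γ`. -/
def PresPoly (Kn : ℕ → Ed d → Ed d → ℝ) (γ : ℝ) : Prop :=
  ∀ n, ∀ k : MIdx d, (mdeg k : ℝ) ≤ γ →
    ∃ p : MvPolynomial (Fin d) ℝ, p.totalDegree ≤ mdeg k ∧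
      ∀ x : Ed d, (∫ y, Kn n x y * mpow y k) = MvPolynomial.eval (fun i => x i) p

/-- Distributional derivative `D^k f (φ) = (-1)^{|k|} f(∂^k φ)`. -/
def distDeriv (k : MIdx d) (f : DFunc d) : DFunc d :=
  fun φ => (-1 : ℝ) ^ (mdeg k) * f (mderiv k φ)

/-- `η ∈ 𝒟` with `∫ η = 1` and vanishing moments of orders `1 ≤ |l| < δ`. -/
def GoodEta (δ : ℝ) (η : Ed d → ℝ) : Prop :=
  IsTest η ∧ (∫ z, η z) = 1 ∧
    ∀ k : MIdx d, 1 ≤ mdeg k → (mdeg k : ℝ) < δ → (∫ z, η z * mpow z k) = 0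

/-- `v` is the pointwise derivative `D^k f(x)`, defined through the limit
`lim_{λ↓0} D^k f(η_x^λ)` for every admissible mollifier `η`. -/
def HasPtDeriv (f : DFunc d) (δ : ℝ) (k : MIdx d) (x : Ed d) (v : ℝ) : Prop :=
  ∀ η : Ed d → ℝ, GoodEta δ η →
    Tendsto (fun l : ℝ => distDeriv k f (scTF η x l)) (nhdsWithin 0 (Set.Ioi 0)) (nhds v)

/-- The Taylor polynomial `Σ_{|k| < δ} c_k (·-x)^k / k!`, viewed as the functional
`ψ ↦ Σ_{|k| < δ} c_k ∫ ψ(y) (y-x)^k / k! dy`. -/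
def taylorF (δ : ℝ) (c : MIdx d → ℝ) (x : Ed d) : DFunc d :=
  fun ψ => ∑ᶠ k ∈ {k : MIdx d | (mdeg k : ℝ) < δ},
    c k * ((∫ y, ψ y * mpow (y - x) k) / (mfact k))

/-- The smallest positive integer `> -γ` (used in Hölder–Zygmund spaces for `γ < 0`). -/
def rNeg (γ : ℝ) : ℕ := (⌊-γ + 1⌋).toNat

/-- The Hölder–Zygmund bound with constant `C` on the compact `K` (with `λ̄ = 1`). -/
def ZBound (γ : ℝ) (f : DFunc d) (K : Set (Ed d)) (C : ℝ) : Prop :=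
  (γ < 0 → ∀ x ∈ K, ∀ l : ℝ, 0 < l → l ≤ 1 → ∀ φ ∈ TB d (rNeg γ),
    |f (scTF φ x l)| ≤ C * l ^ γ) ∧
  (0 ≤ γ →
    (∀ x ∈ K, ∀ ψ ∈ TB d 0, |f (scTF ψ x 1)| ≤ C) ∧
    (∀ x ∈ K, ∀ l : ℝ, 0 < l → l ≤ 1 → ∀ φ ∈ TBAnn d 0 γ,
      |f (scTF φ x l)| ≤ C * l ^ γ))

/-- Membership in the local Hölder–Zygmund space `𝒵^γ`. -/
def MemZ (γ : ℝ) (f : DFunc d) : Prop :=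
  IsDistribution f ∧ ∀ K : Set (Ed d), IsCompact K → ∃ C, ZBound γ f K C

/-- `(Pg, Gg)` is a model with homogeneities `α` of order `rP`, with index set `S`. -/
def IsModelOn {ι : Type} (S : Finset ι) (Pg : ι → GermF d)
    (Gg : ι → ι → Ed d → Ed d → ℝ) (α : ι → ℝ) (rP : ℕ) : Prop :=
  (∀ i ∈ S, IsGerm (Pg i)) ∧
  (∀ i ∈ S, Homog (Pg i) (α i) rP) ∧
  (∀ i ∈ S, ∀ x y : Ed d, ∀ φ : Ed d → ℝ, IsTest φ →
    Pg i y φ = ∑ j ∈ S, Pg j x φ * Gg j i x y)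

/-- The modelled-distribution bound with constant `C` on the compact `K`. -/
def MDB {ι : Type} (S : Finset ι) (Gg : ι → ι → Ed d → Ed d → ℝ) (α : ι → ℝ)
    (γ : ℝ) (f : Ed d → ι → ℝ) (K : Set (Ed d)) (C : ℝ) : Prop :=
  (∀ x ∈ K, ∀ i ∈ S, |f x i| ≤ C) ∧
  (∀ x ∈ K, ∀ y ∈ K, ∀ i ∈ S,
    |(∑ j ∈ S, Gg i j x y * f y j) - f x i| ≤ C * (dist y x) ^ (γ - α i))

/-- `f` is a modelled distribution of order `γ` relative to the model data. -/
def IsMD {ι : Type} (S : Finset ι) (Gg : ι → ι → Ed d → Ed d → ℝ) (α : ι → ℝ)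
    (γ : ℝ) (f : Ed d → ι → ℝ) : Prop :=
  (∀ i ∈ S, Measurable fun x : Ed d => f x i) ∧
  ∀ K : Set (Ed d), IsCompact K → ∃ C, MDB S Gg α γ f K C

/-- The germ `⟨f, Π⟩_x = Σ_i f^i(x) Π^i_x`. -/
def germOf {ι : Type} (S : Finset ι) (Pg : ι → GermF d) (f : Ed d → ι → ℝ) : GermF d :=
  fun x φ => ∑ i ∈ S, f x i * Pg i x φ

/-! ### Multi-index combinatorics -/

theorem mdeg_add_single (k : MIdx d) (i : Fin d) : mdeg (k + Pi.single i 1) = mdeg k + 1 := by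
  simp [mdeg, Finset.sum_add_distrib]

theorem midx_induction {P : MIdx d → Prop} (h0 : P 0)
    (hs : ∀ k i, (∀ j < i, k j = 0) → P k → P (k + Pi.single i 1)) : ∀ k, P k := by
  have key : ∀ n : ℕ, ∀ k : MIdx d, mdeg k = n → P k := by
    intro n
    induction n with
    | zero =>
      intro k hk
      have : k = 0 := by
        funext i
        have := (Finset.sum_eq_zero_iff.1 hk) i (Finset.mem_univ i)
        simpa using this
      rw [this]; exact h0
    | succ n ih =>
      intro k hk
      have hne : (Finset.univ.filter (fun i => k i ≠ 0)).Nonempty := by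
        by_contra hcon
        rw [Finset.not_nonempty_iff_eq_empty, Finset.filter_eq_empty_iff] at hcon
        have : mdeg k = 0 := by
          unfold mdeg
          apply Finset.sum_eq_zero
          intro i hi
          simpa using hcon hi
        omega
      set i := (Finset.univ.filter (fun i => k i ≠ 0)).min' hne with hi
      have hki : k i ≠ 0 := (Finset.mem_filter.1 (Finset.min'_mem _ hne)).2
      have hmin : ∀ j < i, k j = 0 := by
        intro j hj
        by_contra hkj
        have := Finset.min'_le (Finset.univ.filter (fun i => k i ≠ 0)) j (by simp [hkj])
        exact absurd hj (not_lt.2 this)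
      have hkk : k = (k - Pi.single i 1) + Pi.single i 1 := by
        funext j
        by_cases hj : j = i
        · subst hj; simp; omega
        · simp [hj]
      have hd' : mdeg (k - Pi.single i 1) = n := by
        have := mdeg_add_single (k - Pi.single i 1) i
        rw [← hkk] at this; omega
      rw [hkk]
      refine hs _ _ ?_ (ih _ hd')
      intro j hj
      simp [hmin j hj]
  exact fun k => key _ k rfl

theorem mderiv_zero (f : Ed d → ℝ) : mderiv 0 f = f := by
  unfold mderiv
  induction (List.finRange d) with
  | nil => rfl
  | cons a l ih => simp

theorem foldr_single (k : MIdx d) (i : Fin d) (hi : ∀ j < i, k j = 0) (f : Ed d → ℝ)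
    (l : List (Fin d)) (hl : l.Pairwise (· < ·)) (hmem : i ∈ l) :
    l.foldr (fun j g => (pd j)^[(k + Pi.single i 1 : MIdx d) j] g) f
      = pd i (l.foldr (fun j g => (pd j)^[k j] g) f) := by
  induction l with
  | nil => simp at hmem
  | cons a l ih =>
    rw [List.pairwise_cons] at hl
    by_cases ha : a = i
    · subst ha
      have : ∀ l' : List (Fin d), (∀ j ∈ l', a < j) →
          l'.foldr (fun j g => (pd j)^[(k + Pi.single a 1 : MIdx d) j] g) f
            = l'.foldr (fun j g => (pd j)^[k j] g) f := by
        intro l'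
        induction l' with
        | nil => intro _; rfl
        | cons b l' ih' =>
          intro hb
          have hba : b ≠ a := (hb b (by simp)).ne'
          rw [List.foldr_cons, List.foldr_cons, ih' (fun j hj => hb j (by simp [hj]))]
          simp [hba]
      rw [List.foldr_cons, List.foldr_cons, this l hl.1]
      simp [Function.iterate_succ_apply', -Function.iterate_succ]
    · have hil : i ∈ l := by
        rcases List.mem_cons.1 hmem with h | h
        · exact absurd h.symm ha
        · exact h
      rw [List.foldr_cons, List.foldr_cons, ih hl.2 hil]
      have := hi a (hl.1 i hil)
      simp [this, ha]

theorem mderiv_single (k : MIdx d) (i : Fin d) (hi : ∀ j < i, k j = 0) (f : Ed d → ℝ) :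
    mderiv (k + Pi.single i 1) f = pd i (mderiv k f) :=
  foldr_single k i hi f _ (List.pairwise_lt_finRange d) (List.mem_finRange i)

/-! ### Test functions -/

theorem pd_eq_fderiv {f : Ed d → ℝ} (hf : ContDiff ℝ (⊤ : ℕ∞) f) (i : Fin d) :
    pd i f = fun x => fderiv ℝ f x (EuclideanSpace.single i (1:ℝ)) := by
  funext x
  exact ((hf.differentiable (by simp)) x).lineDeriv_eq_fderiv

theorem isTest_hasLineDerivAt {f : Ed d → ℝ} (hf : ContDiff ℝ (⊤ : ℕ∞) f) (i : Fin d) (x : Ed d) :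
    HasLineDerivAt ℝ f (pd i f x) x (EuclideanSpace.single i (1:ℝ)) :=
  ((hf.differentiable (by simp)) x).lineDifferentiableAt.hasLineDerivAt

theorem pd_contDiff {f : Ed d → ℝ} (hf : ContDiff ℝ (⊤ : ℕ∞) f) (i : Fin d) :
    ContDiff ℝ (⊤ : ℕ∞) (pd i f) := by
  rw [pd_eq_fderiv hf]
  have := (contDiff_infty_iff_fderiv.1 hf).2
  exact this.clm_apply contDiff_const

theorem pd_tsupport {f : Ed d → ℝ} (hf : ContDiff ℝ (⊤ : ℕ∞) f) (i : Fin d) :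
    tsupport (pd i f) ⊆ tsupport f := by
  rw [pd_eq_fderiv hf]
  exact tsupport_fderiv_apply_subset ℝ _

theorem mderiv_test {f : Ed d → ℝ} (hf : IsTest f) (k : MIdx d) :
    IsTest (mderiv k f) ∧ tsupport (mderiv k f) ⊆ tsupport f := by
  induction k using midx_induction with
  | h0 => rw [mderiv_zero]; exact ⟨hf, le_rfl⟩
  | hs k i hi ih =>
    rw [mderiv_single k i hi]
    have h2 := (pd_tsupport ih.1.1 i).trans ih.2
    exact ⟨⟨pd_contDiff ih.1.1 i, hf.2.mono' ((subset_tsupport _).trans h2)⟩, h2⟩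

/-! ### Scaling -/

theorem pd_scTF (i : Fin d) (f : Ed d → ℝ) (x : Ed d) (l : ℝ) :
    pd i (scTF f x l) = l⁻¹ • scTF (pd i f) x l := by
  funext y
  simp only [pd, scTF, lineDeriv, Pi.smul_apply, smul_eq_mul]
  have h1 : (fun t : ℝ => (l ^ d)⁻¹ * f (l⁻¹ • (y + t • EuclideanSpace.single i (1:ℝ) - x)))
      = fun t : ℝ => (l ^ d)⁻¹ *
        (fun s : ℝ => f (l⁻¹ • (y - x) + s • EuclideanSpace.single i (1:ℝ))) (l⁻¹ * t) := by
    funext t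
    simp only
    congr 2
    rw [mul_smul, ← smul_add]
    congr 1
    abel
  rw [h1, deriv_const_mul_field,
    deriv_comp_mul_left l⁻¹ (fun s : ℝ => f (l⁻¹ • (y - x) + s • EuclideanSpace.single i (1:ℝ))) 0]
  simp
  ring

theorem pd_smul (i : Fin d) (f : Ed d → ℝ) (c : ℝ) : pd i (c • f) = c • pd i f := by
  funext y
  simp only [pd, lineDeriv, Pi.smul_apply, smul_eq_mul]
  rw [deriv_const_mul_field]

theorem mderiv_smul (k : MIdx d) (f : Ed d → ℝ) (c : ℝ) : mderiv k (c • f) = c • mderiv k f := by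
  induction k using midx_induction with
  | h0 => simp [mderiv_zero]
  | hs k i hi ih => rw [mderiv_single k i hi, mderiv_single k i hi, ih, pd_smul]

theorem mderiv_scTF (k : MIdx d) (f : Ed d → ℝ) (x : Ed d) (l : ℝ) :
    mderiv k (scTF f x l) = (l⁻¹ ^ mdeg k) • scTF (mderiv k f) x l := by
  induction k using midx_induction with
  | h0 => simp [mderiv_zero, mdeg]
  | hs k i hi ih =>
    rw [mderiv_single k i hi, mderiv_single k i hi, ih, pd_smul, pd_scTF, mdeg_add_single, smul_smul,
      pow_succ]

theorem mpow_smul (c : ℝ) (v : Ed d) (k : MIdx d) : mpow (c • v) k = c ^ mdeg k * mpow v k := by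
  simp [mpow, mdeg, mul_pow, Finset.prod_mul_distrib, Finset.prod_pow_eq_pow_sum]

theorem mpow_continuous (k : MIdx d) : Continuous (fun v : Ed d => mpow v k) := by
  unfold mpow
  fun_prop

theorem integral_scTF (f : Ed d → ℝ) (x : Ed d) (l : ℝ) (hl : 0 < l) (k : MIdx d) :
    (∫ y, scTF f x l y * mpow (y - x) k) = l ^ mdeg k * ∫ z, f z * mpow z k := by
  have h1 : (fun y => scTF f x l y * mpow (y - x) k)
      = fun y => (fun z => (l ^ d)⁻¹ * l ^ mdeg k *
          ((fun w => f w * mpow w k) (l⁻¹ • z))) (y - x) := by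
    funext y
    have hl1 : l ^ mdeg k * l⁻¹ ^ mdeg k = 1 := by
      rw [← mul_pow, mul_inv_cancel₀ hl.ne', one_pow]
    simp only [scTF, mpow_smul]
    linear_combination (-(l ^ d)⁻¹ * f (l⁻¹ • (y - x)) * mpow (y - x) k) * hl1
  rw [h1, integral_sub_right_eq_self (fun z => (l ^ d)⁻¹ * l ^ mdeg k *
          ((fun w => f w * mpow w k) (l⁻¹ • z))) x, integral_const_mul,
    Measure.integral_comp_inv_smul_of_nonneg volume (fun w => f w * mpow w k) hl.le]
  simp
  field_simp

theorem scTF_test {f : Ed d → ℝ} (hf : IsTest f) (x : Ed d) {l : ℝ} (hl : 0 < l) :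
    IsTest (scTF f x l) := by
  refine ⟨?_, ?_⟩
  · unfold scTF
    refine contDiff_const.mul (hf.1.comp ?_)
    exact (contDiff_id.sub contDiff_const).const_smul l⁻¹
  · have h1 : HasCompactSupport (fun y => f (l⁻¹ • (y - x))) := by
      have := hf.2.comp_homeomorph ((Homeomorph.subRight x).trans
        (Homeomorph.smulOfNeZero (α := Ed d) l⁻¹ (inv_ne_zero hl.ne')))
      exact this
    exact h1.mul_left

/-! ### Integration by parts -/

theorem mpow_hasLineDerivAt (k : MIdx d) (i : Fin d) (x : Ed d) :
    HasLineDerivAt ℝ (fun v : Ed d => mpow v k)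
      ((k i : ℝ) * mpow x (k - Pi.single i 1)) x (EuclideanSpace.single i (1:ℝ)) := by
  unfold HasLineDerivAt
  have h1 : ∀ t : ℝ, mpow (x + t • EuclideanSpace.single i (1:ℝ)) k
      = (x i + t) ^ (k i) * ∏ j ∈ Finset.univ.erase i, (x j) ^ (k j) := by
    intro t
    unfold mpow
    rw [← Finset.mul_prod_erase _ _ (Finset.mem_univ i)]
    congr 1
    · simp
    · apply Finset.prod_congr rfl
      intro j hj
      have : j ≠ i := Finset.ne_of_mem_erase hj
      simp [this]
  have h2 : mpow x (k - Pi.single i 1)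
      = (x i) ^ (k i - 1) * ∏ j ∈ Finset.univ.erase i, (x j) ^ (k j) := by
    unfold mpow
    rw [← Finset.mul_prod_erase _ _ (Finset.mem_univ i)]
    congr 1
    · simp
    · apply Finset.prod_congr rfl
      intro j hj
      have : j ≠ i := Finset.ne_of_mem_erase hj
      simp [this]
  simp_rw [h1]
  rw [h2]
  have h3 : HasDerivAt (fun t : ℝ => (x i + t) ^ (k i)) ((k i : ℝ) * (x i + 0) ^ (k i - 1) * 1) 0 :=
    ((hasDerivAt_id (0:ℝ)).const_add (x i)).pow (k i)
  have h4 := h3.mul_const (∏ j ∈ Finset.univ.erase i, (x j) ^ (k j))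
  have h5 : ∀ P : ℝ, (k i : ℝ) * (x i + 0) ^ (k i - 1) * 1 * P = (k i : ℝ) * ((x i) ^ (k i - 1) * P) := by
    intro P; rw [add_zero]; ring
  rw [h5] at h4
  exact h4

theorem test_mul_integrable {f : Ed d → ℝ} (hf : IsTest f) (k : MIdx d) :
    Integrable (fun z => f z * mpow z k) :=
  (hf.1.continuous.mul (mpow_continuous k)).integrable_of_hasCompactSupport hf.2.mul_right

theorem integral_pd {f : Ed d → ℝ} (hf : IsTest f) (i : Fin d) (k : MIdx d) :
    (∫ z, pd i f z * mpow z k) = -((k i : ℝ) * ∫ z, f z * mpow z (k - Pi.single i 1)) := by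
  have hpd : IsTest (pd i f) :=
    ⟨pd_contDiff hf.1 i, hf.2.mono' ((subset_tsupport _).trans (pd_tsupport hf.1 i))⟩
  have := integral_bilinear_hasLineDerivAt_right_eq_neg_left_of_integrable (μ := volume)
    (f := fun z : Ed d => mpow z k) (f' := fun z => (k i : ℝ) * mpow z (k - Pi.single i 1))
    (g := f) (g' := pd i f) (v := EuclideanSpace.single i (1:ℝ)) (B := ContinuousLinearMap.mul ℝ ℝ)
    (by
      have := (test_mul_integrable hf (k - Pi.single i 1)).const_mul (k i : ℝ)
      refine this.congr (Eventually.of_forall fun z => ?_)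
      simp; ring)
    (by
      refine (test_mul_integrable hpd k).congr (Eventually.of_forall fun z => ?_)
      simp; ring)
    (by
      refine (test_mul_integrable hf k).congr (Eventually.of_forall fun z => ?_)
      simp; ring)
    (fun x _ => mpow_hasLineDerivAt k i x)
    (fun x _ => isTest_hasLineDerivAt hf.1 i x)
  simp only [ContinuousLinearMap.mul_apply'] at this
  rw [← integral_const_mul]
  convert this using 1
  · congr 1; funext z; ring
  · congr 2; funext z; ring

theorem integral_mderiv {f : Ed d → ℝ} (hf : IsTest f) (k : MIdx d) : ∀ k' : MIdx d,
    (∫ z, mderiv k f z * mpow z k')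
      = (-1) ^ mdeg k * ((∏ i, (k' i).descFactorial (k i) : ℕ) : ℝ) * ∫ z, f z * mpow z (k' - k) := by
  induction k using midx_induction with
  | h0 => intro k'; simp [mderiv_zero, mdeg]
  | hs k i hi ih =>
    intro k'
    rw [mderiv_single k i hi, integral_pd (mderiv_test hf k).1, ih, mdeg_add_single]
    have h1 : k' - Pi.single i 1 - k = k' - (k + Pi.single i 1) := by
      funext j; simp; omega
    have h3 : ∀ j, (k' - Pi.single i 1 : MIdx d) j = if j = i then k' i - 1 else k' j := by
      intro j
      by_cases hj : j = i
      · subst hj; simp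
      · simp [hj]
    have h2 : (∏ j, (k' j).descFactorial ((k + Pi.single i 1 : MIdx d) j))
        = k' i * ∏ j, ((k' - Pi.single i 1 : MIdx d) j).descFactorial (k j) := by
      simp_rw [h3]
      rw [← Finset.mul_prod_erase _ _ (Finset.mem_univ i),
        ← Finset.mul_prod_erase (Finset.univ)
          (fun j => (if j = i then k' i - 1 else k' j).descFactorial (k j))
          (Finset.mem_univ i), ← mul_assoc]
      congr 1
      · rcases Nat.eq_zero_or_pos (k' i) with h | h
        · simp [h]
        · obtain ⟨n, hn⟩ := Nat.exists_eq_succ_of_ne_zero h.ne'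
          simp [hn, Nat.succ_descFactorial_succ, -Nat.descFactorial_succ]
      · apply Finset.prod_congr rfl
        intro j hj
        have : j ≠ i := Finset.ne_of_mem_erase hj
        simp [this]
    rw [h1, h2]
    push_cast
    ring
/-! ### Differentiation of parametric integrals -/

/-- Generic differentiation under an integral over a compact set. -/
theorem hasDerivAt_setIntegral {Y : Type*} [TopologicalSpace Y] [MeasurableSpace Y]
    [OpensMeasurableSpace Y] [T2Space Y] [SecondCountableTopology Y]
    {μ : Measure Y} [IsFiniteMeasureOnCompacts μ] {S : Set Y} (hS : IsCompact S)
    (u u' : ℝ → Y → ℝ) (hu : Continuous (fun q : ℝ × Y => u q.1 q.2))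
    (hu' : Continuous (fun q : ℝ × Y => u' q.1 q.2))
    (hd : ∀ t y, HasDerivAt (fun s => u s y) (u' t y) t) (t₀ : ℝ) :
    HasDerivAt (fun t => ∫ y in S, u t y ∂μ) (∫ y in S, u' t₀ y ∂μ) t₀ := by
  have hcomp : IsCompact (closedBall t₀ 1 ×ˢ S) := (isCompact_closedBall t₀ 1).prod hS
  obtain ⟨C, hC⟩ := hcomp.exists_bound_of_continuousOn hu'.continuousOn
  have hcu : ∀ t, Continuous (u t) := fun t => hu.comp (by fun_prop : Continuous fun y => (t, y))
  have hcu' : ∀ t, Continuous (u' t) := fun t => hu'.comp (by fun_prop : Continuous fun y => (t, y))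
  refine (hasDerivAt_integral_of_dominated_loc_of_deriv_le (μ := μ.restrict S)
    (F := u) (F' := u') (bound := fun _ => C) (closedBall_mem_nhds t₀ one_pos)
    (Eventually.of_forall fun t => (hcu t).aestronglyMeasurable) ?_
    (hcu' t₀).aestronglyMeasurable ?_ ?_ ?_).2
  · exact (hcu t₀).continuousOn.integrableOn_compact hS
  · refine (ae_restrict_iff' hS.measurableSet).2 (Eventually.of_forall fun y hy t ht => ?_)
    exact hC (t, y) ⟨ht, hy⟩
  · exact continuousOn_const.integrableOn_compact hS
  · exact Eventually.of_forall fun y t _ => hd t y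

/-- line differentiability at all points gives derivatives along the line -/
theorem hasDerivAt_line {h h' : Ed d → ℝ} {v : Ed d} (hd : ∀ y, HasLineDerivAt ℝ h (h' y) y v)
    (y : Ed d) (t : ℝ) : HasDerivAt (fun s : ℝ => h (y + s • v)) (h' (y + t • v)) t := by
  have h1 := hd (y + t • v)
  unfold HasLineDerivAt at h1
  have h2 : HasDerivAt (fun s : ℝ => s - t) 1 t := (hasDerivAt_id t).sub_const t
  have h1' : HasDerivAt (fun s : ℝ => h (y + t • v + s • v)) (h' (y + t • v)) (t - t) := by
    rw [sub_self]; exact h1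
  have h3 := HasDerivAt.scomp (h := fun s : ℝ => s - t) t h1' h2
  rw [one_smul] at h3
  refine h3.congr_of_eventuallyEq (Eventually.of_forall fun s => ?_)
  simp only [Function.comp]
  congr 1
  rw [add_assoc, ← add_smul]
  congr 2
  ring

/-- A version of the Schwarz theorem on mixed derivatives. -/
theorem schwarz {h a b c : Ed d → ℝ} {v w : Ed d}
    (ha : ∀ y, HasLineDerivAt ℝ h (a y) y v)
    (hb : ∀ y, HasLineDerivAt ℝ h (b y) y w) (hbc : Continuous b)
    (hc : ∀ y, HasLineDerivAt ℝ b (c y) y v) (hcc : Continuous c) (y : Ed d) :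
    HasLineDerivAt ℝ a (c y) y w := by
  -- fundamental theorem in the direction `w`
  have hftc : ∀ z : Ed d, ∀ t : ℝ, 0 < t →
      h (z + t • w) - h z = ∫ τ in Set.Icc 0 t, b (z + τ • w) := by
    intro z t ht
    have := intervalIntegral.integral_eq_sub_of_hasDerivAt (a := 0) (b := t)
      (fun τ _ => hasDerivAt_line hb z τ)
      ((hbc.comp (by fun_prop : Continuous fun τ : ℝ => z + τ • w)).intervalIntegrable 0 t)
    rw [intervalIntegral.integral_of_le ht.le, ← integral_Icc_eq_integral_Ioc] at this
    rw [this]; simp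
  have hkey : ∀ z : Ed d, ∀ t : ℝ, 0 < t →
      a (z + t • w) - a z = ∫ τ in (0:ℝ)..t, c (z + τ • w) := by
    intro z t ht
    have h1 : HasDerivAt (fun s : ℝ => h (z + t • w + s • v) - h (z + s • v))
        (a (z + t • w) - a z) 0 := (ha (z + t • w)).sub (ha z)
    have h2 := hasDerivAt_setIntegral (μ := (volume : Measure ℝ)) (isCompact_Icc (a := (0:ℝ)) (b := t))
      (fun s τ => b (z + τ • w + s • v)) (fun s τ => c (z + τ • w + s • v))
      (hbc.comp (by fun_prop)) (hcc.comp (by fun_prop))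
      (fun s τ => hasDerivAt_line hc (z + τ • w) s) 0
    have h3 : (fun s : ℝ => h (z + t • w + s • v) - h (z + s • v))
        = fun s : ℝ => ∫ τ in Set.Icc 0 t, b (z + τ • w + s • v) := by
      funext s
      rw [add_right_comm z (t • w) (s • v), hftc _ _ ht]
      congr 1
      funext τ
      rw [add_right_comm]
    rw [h3] at h1
    rw [h1.unique h2, intervalIntegral.integral_of_le ht.le, ← integral_Icc_eq_integral_Ioc]
    simp
  -- base point moved one step back so that `t` ranges over positive times
  set z := y - w with hz
  have hcont : Continuous fun τ : ℝ => c (z + τ • w) := hcc.comp (by fun_prop)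
  have hder : HasDerivAt (fun t : ℝ => ∫ τ in (0:ℝ)..t, c (z + τ • w)) (c (z + (1:ℝ) • w)) 1 :=
    intervalIntegral.integral_hasDerivAt_right (hcont.intervalIntegrable _ _)
      (hcont.stronglyMeasurableAtFilter _ _) hcont.continuousAt
  have hder2 : HasDerivAt (fun t : ℝ => a (z + t • w)) (c (z + (1:ℝ) • w)) 1 := by
    refine (hder.add_const (a z)).congr_of_eventuallyEq ?_
    filter_upwards [lt_mem_nhds (zero_lt_one : (0:ℝ) < 1)] with t ht
    rw [← hkey z t ht]; ring
  have hzy : z + (1:ℝ) • w = y := by simp [hz]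
  rw [hzy] at hder2
  unfold HasLineDerivAt
  have h2 : HasDerivAt (fun s : ℝ => s + 1) 1 0 := (hasDerivAt_id (0:ℝ)).add_const 1
  have h1' : HasDerivAt (fun t : ℝ => a (z + t • w)) (c y) (0 + 1) := by
    rw [zero_add]; exact hder2
  have h3 := HasDerivAt.scomp (0:ℝ) h1' h2
  rw [one_smul] at h3
  refine h3.congr_of_eventuallyEq (Eventually.of_forall fun s => ?_)
  simp only [Function.comp]
  congr 1
  rw [add_smul, one_smul, hz]
  abel

theorem mdeg_add_lt {k : MIdx d} {r : ℕ} {i : Fin d} (h : mdeg (k + Pi.single i 1) ≤ r) :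
    mdeg k < r := by
  rw [mdeg_add_single] at h; omega

/-- For a `C^r` function all the orders of differentiation agree. -/
theorem isCr_hasLineDerivAt {r : ℕ} {f : Ed d → ℝ} (hf : IsCr r f) (k : MIdx d) :
    mdeg k < r → ∀ (j : Fin d) (y : Ed d),
      HasLineDerivAt ℝ (mderiv k f) (mderiv (k + Pi.single j 1) f y) y
        (EuclideanSpace.single j (1:ℝ)) := by
  have base : ∀ (k : MIdx d) (j : Fin d), mdeg k < r → (∀ i < j, k i = 0) → ∀ y,
      HasLineDerivAt ℝ (mderiv k f) (mderiv (k + Pi.single j 1) f y) y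
        (EuclideanSpace.single j (1:ℝ)) := by
    intro k j hk hj y
    rw [mderiv_single k j hj]
    exact ((hf k hk.le).2 hk j y).hasLineDerivAt
  induction k using midx_induction with
  | h0 => intro h j y; exact base 0 j h (by simp) y
  | hs k i hi ih =>
    intro h j y
    have hk : mdeg k < r := mdeg_add_lt h.le
    have hkj : mdeg (k + Pi.single j 1) < r := by rw [mdeg_add_single] at h ⊢; exact h
    by_cases hij : j ≤ i
    · refine base _ j h ?_ y
      intro i' hi'
      have : i' ≠ i := (lt_of_lt_of_le hi' hij).ne
      simp [this, hi i' (lt_of_lt_of_le hi' hij)]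
    · push Not at hij
      have hi2 : ∀ i' < i, (k + Pi.single j 1 : MIdx d) i' = 0 := by
        intro i' hi'
        have : i' ≠ j := (hi'.trans hij).ne
        simp [this, hi i' hi']
      have e : k + Pi.single i 1 + Pi.single j 1 = k + Pi.single j 1 + Pi.single i 1 :=
        add_right_comm _ _ _
      rw [e]
      refine schwarz (h := mderiv k f) (b := mderiv (k + Pi.single j 1) f)
        (v := EuclideanSpace.single i (1:ℝ)) (fun y => base k i hk hi y) (fun y => ih hk j y)
        (hf _ hkj.le).1 (fun y => base _ i hkj hi2 y) (hf _ ?_).1 y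
      rw [mdeg_add_single]; exact hkj

/-! ### The adjoint kernel maps test functions to `C^r` functions -/

theorem integral_eq_set {ψ : Ed d → ℝ} (q : Ed d → ℝ) :
    (∫ x, ψ x * q x) = ∫ x in tsupport ψ, ψ x * q x := by
  rw [setIntegral_eq_integral_of_forall_compl_eq_zero]
  intro x hx
  rw [image_eq_zero_of_notMem_tsupport hx, zero_mul]

theorem isCmr_isCr {m r : ℕ} {Kf : Ed d → Ed d → ℝ} (hK : IsCmr m r Kf) (x : Ed d) :
    IsCr r (fun y => Kf x y) := by
  intro l hl
  have h := hK 0 l (by simp [mdeg]) hl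
  refine ⟨?_, fun hlr i y => h.2.2 hlr i x y⟩
  have h1 := h.1
  simp only [mixDeriv, mderiv_zero] at h1
  exact h1.comp (by fun_prop : Continuous fun y : Ed d => (x, y))

theorem isCmr_cont {m r : ℕ} {Kf : Ed d → Ed d → ℝ} (hK : IsCmr m r Kf) {l : MIdx d}
    (hl : mdeg l ≤ r) : Continuous (fun q : Ed d × Ed d => mderiv l (fun y' => Kf q.1 y') q.2) := by
  have h1 := (hK 0 l (by simp [mdeg]) hl).1
  simpa only [mixDeriv, mderiv_zero] using h1

theorem kstar_mderiv {m r : ℕ} {Kf : Ed d → Ed d → ℝ} (hK : IsCmr m r Kf) {ψ : Ed d → ℝ}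
    (hψ : IsTest ψ) (k : MIdx d) : mdeg k ≤ r →
    mderiv k (kstar Kf ψ) = (fun y => ∫ x, ψ x * mderiv k (fun y' => Kf x y') y) ∧
    (mdeg k < r → ∀ (j : Fin d) (y : Ed d), HasLineDerivAt ℝ (mderiv k (kstar Kf ψ))
      (∫ x, ψ x * mderiv (k + Pi.single j 1) (fun y' => Kf x y') y) y
        (EuclideanSpace.single j (1:ℝ))) := by
  have hcψ := hψ.1.continuous
  have aux : ∀ k : MIdx d, mdeg k < r → ∀ (j : Fin d) (y : Ed d),
      HasLineDerivAt ℝ (fun y => ∫ x, ψ x * mderiv k (fun y' => Kf x y') y)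
      (∫ x, ψ x * mderiv (k + Pi.single j 1) (fun y' => Kf x y') y) y
        (EuclideanSpace.single j (1:ℝ)) := by
    intro k hk j y
    have hk' : mdeg (k + Pi.single j 1) ≤ r := by rw [mdeg_add_single]; exact hk
    have hL := fun x => isCr_hasLineDerivAt (isCmr_isCr hK x) k hk j
    generalize (k + Pi.single j 1 : MIdx d) = k' at hk' hL ⊢
    unfold HasLineDerivAt
    simp_rw [integral_eq_set]
    have := hasDerivAt_setIntegral (μ := (volume : Measure (Ed d))) (S := tsupport ψ) hψ.2
      (fun t x => ψ x * mderiv k (fun y' => Kf x y') (y + t • EuclideanSpace.single j (1:ℝ)))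
      (fun t x => ψ x * mderiv k' (fun y' => Kf x y')
        (y + t • EuclideanSpace.single j (1:ℝ)))
      ((hcψ.comp continuous_snd).mul ((isCmr_cont hK hk.le).comp
        (by fun_prop : Continuous fun q : ℝ × Ed d =>
          (q.2, y + q.1 • EuclideanSpace.single j (1:ℝ)))))
      ((hcψ.comp continuous_snd).mul ((isCmr_cont hK hk').comp
        (by fun_prop : Continuous fun q : ℝ × Ed d =>
          (q.2, y + q.1 • EuclideanSpace.single j (1:ℝ)))))
      (fun t x => (hasDerivAt_line (hL x) y t).const_mul (ψ x)) 0
    simpa using this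
  have main : mdeg k ≤ r →
      mderiv k (kstar Kf ψ) = (fun y => ∫ x, ψ x * mderiv k (fun y' => Kf x y') y) := by
    induction k using midx_induction with
    | h0 => intro _; simp only [mderiv_zero]; rfl
    | hs k i hi ih =>
      intro h
      have hk : mdeg k < r := mdeg_add_lt h
      rw [mderiv_single k i hi, ih hk.le]
      funext y
      exact (aux k hk i y).lineDeriv
  intro h
  refine ⟨main h, fun hk j y => ?_⟩
  rw [main h]
  exact aux k hk j y

theorem kstar_isCr {m r : ℕ} {Kf : Ed d → Ed d → ℝ} (hK : IsCmr m r Kf) {ψ : Ed d → ℝ}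
    (hψ : IsTest ψ) : IsCr r (kstar Kf ψ) := by
  intro k hk
  have h := kstar_mderiv hK hψ k hk
  refine ⟨?_, fun hlt i y => (h.2 hlt i y).lineDifferentiableAt⟩
  rw [h.1]
  simp_rw [integral_eq_set]
  have hcψ := hψ.1.continuous
  refine continuous_parametric_integral_of_continuous
    (f := fun y x => ψ x * mderiv k (fun y' => Kf x y') y) ?_ hψ.2
  exact (hcψ.comp continuous_snd).mul ((isCmr_cont hK hk).comp
    (by fun_prop : Continuous fun q : Ed d × Ed d => (q.2, q.1)))

theorem kstar_compact {Kf : Ed d → Ed d → ℝ} {D : ℝ} (hK : ∀ x y, Kf x y ≠ 0 → dist x y ≤ D)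
    {ψ : Ed d → ℝ} (hψ : IsTest ψ) : HasCompactSupport (kstar Kf ψ) := by
  refine HasCompactSupport.intro (hψ.2.cthickening (r := D)) ?_
  intro y hy
  unfold kstar
  rw [← integral_zero (Ed d) ℝ (μ := volume)]
  congr 1
  funext x
  by_contra hne
  have h1 : ψ x ≠ 0 := fun h => hne (by simp [h])
  have h2 : Kf x y ≠ 0 := fun h => hne (by simp [h])
  refine hy (mem_cthickening_of_dist_le y x D _ (subset_tsupport _ h1) ?_)
  rw [dist_comm]; exact hK x y h2

theorem kstar_smul (Kf : Ed d → Ed d → ℝ) (c : ℝ) (ψ : Ed d → ℝ) :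
    kstar Kf (c • ψ) = c • kstar Kf ψ := by
  funext y
  simp only [kstar, Pi.smul_apply, smul_eq_mul]
  rw [← integral_const_mul]
  congr 1
  funext x
  ring

/-! ### Existence of good mollifiers -/

theorem exists_goodEta (δ : ℝ) : ∃ η : Ed d → ℝ, GoodEta δ η ∧ tsupport η ⊆ closedBall 0 1 := by
  obtain ⟨N, hN⟩ := exists_nat_gt δ
  let φ : ContDiffBump (0 : Ed d) := ⟨1/2, 1, by norm_num, by norm_num⟩
  set f : Ed d → ℝ := φ.normed volume with hf
  have hft : IsTest f := ⟨φ.contDiff_normed, φ.hasCompactSupport_normed⟩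
  have hfs : tsupport f = closedBall 0 1 := φ.tsupport_normed_eq
  have hfi : ∫ z, f z = 1 := φ.integral_normed
  let v : ℕ → ℝ := fun j => ((j : ℝ) + 1)⁻¹
  have hv0 : ∀ j, 0 < v j := fun j => by positivity
  have hv1 : ∀ j, v j ≤ 1 := fun j => inv_le_one_of_one_le₀ (by simp)
  have hvi : Set.InjOn v (Finset.range (N + 1)) := by
    intro a _ b _ hab
    have : (a : ℝ) + 1 = b + 1 := inv_injective hab
    exact_mod_cast add_right_cancel this
  let c : ℕ → ℝ := fun j => (Lagrange.basis (Finset.range (N + 1)) v j).eval 0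
  have hc : ∀ n ≤ N, ∑ j ∈ Finset.range (N + 1), c j * v j ^ n = 0 ^ n := by
    intro n hn
    have h := Lagrange.eq_interpolate (f := (Polynomial.X ^ n : Polynomial ℝ)) hvi (by
      rw [Polynomial.degree_X_pow]
      simp only [Finset.card_range]
      exact_mod_cast Nat.lt_succ_of_le hn)
    have h2 := congrArg (Polynomial.eval (0:ℝ)) h
    rw [Lagrange.interpolate_apply, Polynomial.eval_finsetSum] at h2
    simp only [Polynomial.eval_pow, Polynomial.eval_X, Polynomial.eval_mul, Polynomial.eval_C] at h2
    rw [h2]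
    exact Finset.sum_congr rfl fun j _ => mul_comm _ _
  let η : Ed d → ℝ := fun z => ∑ j ∈ Finset.range (N + 1), c j * scTF f 0 (v j) z
  have hsub : ∀ z, z ∉ closedBall (0 : Ed d) 1 → η z = 0 := by
    intro z hz
    apply Finset.sum_eq_zero
    intro j _
    have : f ((v j)⁻¹ • (z - 0)) = 0 := by
      apply image_eq_zero_of_notMem_tsupport
      rw [hfs]
      intro hmem
      apply hz
      simp only [mem_closedBall, dist_zero_right, sub_zero, norm_smul] at hmem ⊢
      have h1 : (1:ℝ) ≤ ‖(v j)⁻¹‖ := by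
        rw [Real.norm_of_nonneg (inv_nonneg.2 (hv0 j).le)]
        exact (one_le_inv₀ (hv0 j)).2 (hv1 j)
      nlinarith [norm_nonneg z]
    simp only [scTF, this, mul_zero]
  have hts : tsupport η ⊆ closedBall 0 1 := by
    refine closure_minimal ?_ isClosed_closedBall
    intro z hz
    by_contra h
    exact hz (hsub z h)
  have htest : IsTest η := by
    refine ⟨?_, HasCompactSupport.intro (isCompact_closedBall 0 1) hsub⟩
    exact ContDiff.sum fun j _ => contDiff_const.mul (scTF_test hft 0 (hv0 j)).1
  have hmom : ∀ k : MIdx d, mdeg k ≤ N → (∫ z, η z * mpow z k) = 0 ^ mdeg k * ∫ z, f z * mpow z k := by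
    intro k hk
    have h1 : (fun z => η z * mpow z k)
        = fun z => ∑ j ∈ Finset.range (N + 1), c j * (scTF f 0 (v j) z * mpow z k) := by
      funext z
      simp only [η, Finset.sum_mul, mul_assoc]
    rw [h1, integral_finsetSum _ fun j _ =>
      (test_mul_integrable (scTF_test hft 0 (hv0 j)) k).const_mul (c j), ← hc _ hk, Finset.sum_mul]
    refine Finset.sum_congr rfl fun j _ => ?_
    rw [integral_const_mul]
    have := integral_scTF f 0 (v j) (hv0 j) k
    simp only [sub_zero] at this
    rw [this]; ring
  refine ⟨η, ⟨htest, ?_, ?_⟩, hts⟩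
  · have := hmom 0 (by simp [mdeg])
    simpa [mpow, mdeg, hfi] using this
  · intro k hk1 hkd
    have hkN : mdeg k ≤ N := by
      have : (mdeg k : ℝ) < N := hkd.trans hN
      exact_mod_cast this.le
    rw [hmom k hkN, zero_pow (by omega), zero_mul]

/-- Every test function supported in the unit ball is a multiple of an element of `𝓑^r`. -/
theorem exists_smul_mem_TB {ξ : Ed d → ℝ} (hξ : IsTest ξ) (hs : tsupport ξ ⊆ closedBall 0 1)
    (r : ℕ) : ∃ M : ℝ, 0 < M ∧ M⁻¹ • ξ ∈ TB d r := by
  have hb : ∀ k : MIdx d, ∃ C, ∀ x, ‖mderiv k ξ x‖ ≤ C := fun k =>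
    (mderiv_test hξ k).1.2.exists_bound_of_continuous (mderiv_test hξ k).1.1.continuous
  choose C hC using hb
  have hC0 : ∀ k, 0 ≤ C k := fun k => (norm_nonneg _).trans (hC k 0)
  set M : ℝ := 1 + ∑ k ∈ Finset.Iic (fun _ => r : MIdx d), C k with hM
  have hMpos : 0 < M := by
    have : 0 ≤ ∑ k ∈ Finset.Iic (fun _ => r : MIdx d), C k := Finset.sum_nonneg fun k _ => hC0 k
    linarith
  refine ⟨M, hMpos, ⟨contDiff_const.smul hξ.1, hξ.2.smul_left (f := fun _ => M⁻¹)⟩, ?_, ?_⟩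
  · exact (tsupport_smul_subset_right (fun _ => M⁻¹) ξ).trans hs
  · intro k hk x
    have hmem : k ∈ Finset.Iic (fun _ => r : MIdx d) := by
      rw [Finset.mem_Iic]
      intro i
      exact (Finset.single_le_sum (f := k) (fun j _ => Nat.zero_le _) (Finset.mem_univ i)).trans hk
    have h1 : C k ≤ M := by
      have := Finset.single_le_sum (f := C) (fun j _ => hC0 j) hmem
      linarith
    rw [mderiv_smul, Pi.smul_apply, smul_eq_mul, abs_mul, abs_of_pos (inv_pos.2 hMpos),
      inv_mul_le_iff₀ hMpos, mul_one]
    exact (hC k x).trans h1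

/-- The polynomial, tested against a rescaled derivative of a good mollifier,
returns its coefficient. -/
theorem taylorF_deriv {δ : ℝ} {η : Ed d → ℝ} (hη : GoodEta δ η) (c : MIdx d → ℝ) (x : Ed d)
    (k : MIdx d) (hk : (mdeg k : ℝ) < δ) {l : ℝ} (hl : 0 < l) (M : ℝ) :
    taylorF δ c x (scTF (M⁻¹ • mderiv k η) x l) = M⁻¹ * l ^ mdeg k * (-1) ^ mdeg k * c k := by
  have hterm : ∀ k' : MIdx d, (∫ y, scTF (M⁻¹ • mderiv k η) x l y * mpow (y - x) k')
      = l ^ mdeg k' * (M⁻¹ * ((-1) ^ mdeg k * ((∏ i, (k' i).descFactorial (k i) : ℕ) : ℝ)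
          * ∫ z, η z * mpow z (k' - k))) := by
    intro k'
    rw [integral_scTF _ _ _ hl, ← integral_mderiv hη.1, ← integral_const_mul M⁻¹]
    simp only [Pi.smul_apply, smul_eq_mul, mul_assoc]
  unfold taylorF
  simp_rw [hterm]
  rw [finsum_eq_single _ k]
  · rw [finsum_eq_if, if_pos (by exact hk)]
    have h1 : (∏ i, (k i).descFactorial (k i)) = mfact k := by
      simp [mfact, Nat.descFactorial_self]
    have h2 : (∫ z, η z * mpow z (k - k)) = 1 := by
      rw [tsub_self]
      simpa [mpow] using hη.2.1
    have h3 : (mfact k : ℝ) ≠ 0 := by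
      unfold mfact
      exact_mod_cast Finset.prod_ne_zero_iff.2 fun i _ => Nat.factorial_ne_zero _
    rw [h1, h2]
    field_simp
  · intro k' hne
    rw [finsum_eq_if]
    split_ifs with hk'
    · have hk'' : (mdeg k' : ℝ) < δ := hk'
      by_cases hle : k ≤ k'
      · have hdeg : mdeg k' = mdeg (k' - k) + mdeg k := by
          unfold mdeg
          rw [← Finset.sum_add_distrib]
          exact Finset.sum_congr rfl fun i _ => by
            have : k i ≤ k' i := hle i
            simp only [Pi.sub_apply]; omega
        have hpos : 1 ≤ mdeg (k' - k) := by
          by_contra h0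
          apply hne
          have h0' : mdeg (k' - k) = 0 := by omega
          funext i
          have h1 := (Finset.sum_eq_zero_iff.1 h0') i (Finset.mem_univ i)
          have h2 : k i ≤ k' i := hle i
          simp only [Pi.sub_apply] at h1
          omega
        have hlt : (mdeg (k' - k) : ℝ) < δ := by
          refine lt_of_le_of_lt ?_ hk''
          exact_mod_cast (by omega : mdeg (k' - k) ≤ mdeg k')
        rw [hη.2.2 _ hpos hlt]
        simp
      · obtain ⟨i, hi⟩ : ∃ i, k' i < k i := by
          by_contra hcon
          push Not at hcon
          exact hle hcon
        have : (∏ i, (k' i).descFactorial (k i)) = 0 :=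
          Finset.prod_eq_zero (Finset.mem_univ i) (Nat.descFactorial_eq_zero_iff_lt.2 hi)
        rw [this]
        simp
    · rfl

/-- Proposition 3.11, canonicity of the germ `𝒦^{γ,β}F`: under the
assumptions of the Schauder estimates for coherent germs, if a germ is postulated in the
form `G_x = 𝖪F_x - P_x` with `P_x` a polynomial of degree `< γ+β`, and `𝖪R` is a
`(γ+β)`-reconstruction of `G`, then necessarily
`P_x = 𝒯^{γ+β}_x(𝖪{F_x - R})`, i.e. the coefficients of `P_x` in the basis
`(·-x)^k/k!` are the pointwise derivatives `D^k(𝖪{F_x - R})(x)`. -/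
theorem canonicity_of_KF
    (d : ℕ) (hd : 0 < d) (α γ β ρ : ℝ) (m r : ℕ)
    (hαγ : α ≤ γ) (hγ0 : γ ≠ 0) (hβ : 0 < β) (hαβ : α + β ≠ 0)
    (hγβ : ∀ n : ℕ, γ + β ≠ (n : ℝ)) (hρ : 0 < ρ)
    (hm : γ + β < (m : ℝ)) (hr : -α < (r : ℝ))
    (Kn : ℕ → Ed d → Ed d → ℝ) (hK : RegKer d β m r ρ Kn)
    (F : GermF d) (hF : IsGerm F) (hFcoh : ∃ rF : ℕ, Coh F α γ rF)
    (R : DFunc d) (hR : IsDistribution R) (hrec : IsRec F R α γ)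
    (hext : ∀ x, OrderExt (fun φ => F x φ - R φ) r)
    -- `𝖪R` is well-defined
    (g : DFunc d) (hg : KInt Kn R g)
    -- `𝖪F_x`, `𝖪{F_x - R}` and the pointwise derivatives of the latter
    (KF : GermF d)
    (hKF : ∀ x : Ed d, ∀ ψ : Ed d → ℝ, IsTest ψ →
      HasSum (fun n => F x (kstar (Kn n) ψ)) (KF x ψ))
    (H0 : GermF d)
    (hH0 : ∀ x : Ed d, ∀ ψ : Ed d → ℝ, IsTest ψ →
      HasSum (fun n => F x (kstar (Kn n) ψ) - R (kstar (Kn n) ψ)) (H0 x ψ))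
    (Dv : Ed d → MIdx d → ℝ)
    (hDv : ∀ x : Ed d, ∀ k : MIdx d, (mdeg k : ℝ) < γ + β →
      HasPtDeriv (H0 x) (γ + β) k x (Dv x k))
    -- the postulated polynomial `P_x`, given by its coefficients in the basis `(·-x)^k/k!`
    (p : Ed d → MIdx d → ℝ)
    (hpdeg : ∀ x : Ed d, ∀ k : MIdx d, ¬ ((mdeg k : ℝ) < γ + β) → p x k = 0)
    -- the germ `G_x = 𝖪F_x - P_x`
    (G : GermF d)
    (hG : ∀ x : Ed d, ∀ φ : Ed d → ℝ, G x φ = KF x φ - taylorF (γ + β) (p x) x φ)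
    -- `𝖪R` is a `(γ+β)`-reconstruction of `G`
    (hGrec : IsRec G g (min (α + β) 0) (γ + β)) :
    ∀ x : Ed d, ∀ k : MIdx d, (mdeg k : ℝ) < γ + β → p x k = Dv x k := by
  intro x k hk
  obtain ⟨η, hη, hηs⟩ := exists_goodEta (d := d) (γ + β)
  have hξ := mderiv_test hη.1 k
  obtain ⟨r', hr'⟩ := exists_nat_gt (-(min (α + β) 0))
  obtain ⟨M, hM, hMTB⟩ := exists_smul_mem_TB hξ.1 (hξ.2.trans hηs) r'
  obtain ⟨C, hC⟩ := hGrec r' hr' {x} isCompact_singleton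
  -- `𝖪{F_x - R} = 𝖪F_x - 𝖪R`
  have hH : ∀ ψ : Ed d → ℝ, IsTest ψ → H0 x ψ = KF x ψ - g ψ := fun ψ hψ =>
    (hH0 x ψ hψ).unique ((hKF x ψ hψ).sub (hg ψ hψ))
  -- homogeneity
  have hsm : ∀ (c : ℝ) (ψ : Ed d → ℝ), IsTest ψ → H0 x (c • ψ) = c * H0 x ψ := by
    intro c ψ hψ
    have hcψ : IsTest (c • ψ) := ⟨contDiff_const.smul hψ.1, hψ.2.smul_left (f := fun _ => c)⟩
    refine (hH0 x _ hcψ).unique ?_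
    have h := (hH0 x ψ hψ).mul_left c
    have hfun : (fun n => F x (kstar (Kn n) (c • ψ)) - R (kstar (Kn n) (c • ψ)))
        = fun n => c * (F x (kstar (Kn n) ψ) - R (kstar (Kn n) ψ)) := by
      funext n
      rw [kstar_smul]
      exact (hext x).2.1 c _ (kstar_isCr (hK.1 n) hψ) (kstar_compact (hK.2.1 n) hψ)
    rw [hfun]
    exact h
  have hbound : ∀ l : ℝ, 0 < l → l ≤ 1 →
      |distDeriv k (H0 x) (scTF η x l) - p x k| ≤ M * C * l ^ (γ + β - mdeg k) := by
    intro l hl hl1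
    have hb := hC x rfl l hl hl1 _ hMTB
    set ψ := scTF (mderiv k η) x l with hψ
    have hψt : IsTest ψ := scTF_test hξ.1 x hl
    have e1 : scTF (M⁻¹ • mderiv k η) x l = M⁻¹ • ψ := by
      funext y
      simp only [hψ, scTF, Pi.smul_apply, smul_eq_mul]
      ring
    have hMψt : IsTest (M⁻¹ • ψ) :=
      ⟨contDiff_const.smul hψt.1, hψt.2.smul_left (f := fun _ => M⁻¹)⟩
    have e2 : G x (scTF (M⁻¹ • mderiv k η) x l) - g (scTF (M⁻¹ • mderiv k η) x l)
        = M⁻¹ * (H0 x ψ - l ^ mdeg k * (-1) ^ mdeg k * p x k) := by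
      rw [hG, taylorF_deriv hη _ _ _ hk hl, e1, sub_right_comm, ← hH _ hMψt, hsm _ _ hψt]
      ring
    have e3 : distDeriv k (H0 x) (scTF η x l) - p x k
        = (-1) ^ mdeg k * l⁻¹ ^ mdeg k * (H0 x ψ - l ^ mdeg k * (-1) ^ mdeg k * p x k) := by
      unfold distDeriv
      rw [mderiv_scTF, hsm _ _ hψt]
      have h1 : l⁻¹ ^ mdeg k * l ^ mdeg k = 1 := by
        rw [← mul_pow, inv_mul_cancel₀ hl.ne', one_pow]
      have h2 : ((-1 : ℝ) ^ mdeg k) * (-1) ^ mdeg k = 1 := by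
        rw [← mul_pow]; simp
      linear_combination (p x k * (l⁻¹ ^ mdeg k * l ^ mdeg k)) * h2 + p x k * h1
    rw [e2, abs_mul, abs_of_pos (inv_pos.2 hM), inv_mul_le_iff₀ hM] at hb
    have h3 : l ^ (γ + β - mdeg k) = l ^ (γ + β) * l⁻¹ ^ mdeg k := by
      rw [Real.rpow_sub hl, Real.rpow_natCast, inv_pow, div_eq_mul_inv]
    rw [e3, abs_mul, abs_mul, abs_pow, abs_neg, abs_one, one_pow, one_mul,
      abs_of_pos (pow_pos (inv_pos.2 hl) _), h3]
    calc l⁻¹ ^ mdeg k * |H0 x ψ - l ^ mdeg k * (-1) ^ mdeg k * p x k|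
        ≤ l⁻¹ ^ mdeg k * (M * (C * l ^ (γ + β))) := by gcongr
      _ = M * C * (l ^ (γ + β) * l⁻¹ ^ mdeg k) := by ring
  have hlim := hDv x k hk η hη
  have hz : Tendsto (fun l : ℝ => M * C * l ^ (γ + β - mdeg k)) (nhdsWithin 0 (Set.Ioi 0)) (nhds 0) := by
    have hpos : 0 < γ + β - mdeg k := by linarith
    have h1 := (Real.continuousAt_rpow_const 0 (γ + β - mdeg k) (Or.inr hpos.le)).tendsto
    rw [Real.zero_rpow hpos.ne'] at h1
    have h2 := (h1.mono_left (nhdsWithin_le_nhds (s := Set.Ioi 0))).const_mul (M * C)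
    simpa using h2
  have hlim2 : Tendsto (fun l : ℝ => distDeriv k (H0 x) (scTF η x l) - p x k)
      (nhdsWithin 0 (Set.Ioi 0)) (nhds 0) := by
    refine squeeze_zero_norm' ?_ hz
    filter_upwards [Ioc_mem_nhdsGT (zero_lt_one : (0:ℝ) < 1)] with l hl
    exact hbound l hl.1 hl.2
  have := tendsto_nhds_unique (hlim.sub_const (p x k)) hlim2
  linarith
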